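/- arXiv:1807.08557 — 5 statements merged into one kernel-verified Lean document; each statement's English description precedes it below -/
import Mathlib

section
/- Let X be a topological space, 𝕂 ∈ {ℝ, ℂ}, w : X → 𝕂 continuous and ψ : X → X continuous. Assume (i) the set {x ∈ X : w(x) ≠ 0} is dense in X, and (ii) for every x ∈ X there is an open neighborhood U_x of x in X such that the restriction of ψ to U_x is injective and is an open map onto its image. Then for every m ∈ ℕ₀ the set {y ∈ X : w(ψ^m(y)) ≠ 0} is dense in X, where ψ^m denotes the m-fold iterate of ψ (ψ^0 = id). -/
/-- If `{x | w x ≠ 0}` is dense and every point has an open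
neighborhood on which `ψ` is injective and open, then for every `m` the set
`{y | w (ψ^[m] y) ≠ 0}` is dense. -/
theorem dense_nonvanishing_along_iterates
    {X : Type*} [TopologicalSpace X] {𝕂 : Type*} [RCLike 𝕂]
    (w : X → 𝕂) (ψ : X → X) (hw : Continuous w) (hψ : Continuous ψ)
    (hdense : Dense {x : X | w x ≠ 0})
    (hloc : ∀ x : X, ∃ U : Set X, IsOpen U ∧ x ∈ U ∧ Set.InjOn ψ U ∧
      ∀ V : Set X, IsOpen V → V ⊆ U → IsOpen (ψ '' V)) :
    ∀ m : ℕ, Dense {y : X | w (ψ^[m] y) ≠ 0} := by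
  have hopen : IsOpenMap ψ := by
    intro V hV
    rw [isOpen_iff_forall_mem_open]
    rintro _ ⟨x, hx, rfl⟩
    obtain ⟨U, hU, hxU, -, hUo⟩ := hloc x
    exact ⟨ψ '' (V ∩ U), Set.image_mono Set.inter_subset_left,
      hUo _ (hV.inter hU) Set.inter_subset_right, Set.mem_image_of_mem ψ ⟨hx, hxU⟩⟩
  intro m
  induction m with
  | zero => exact hdense
  | succ k ih => exact ih.preimage hopen
end

section
/- Let X be a topological space, 𝕂 ∈ {ℝ, ℂ}, w : X → 𝕂 continuous and ψ : X → X continuous. If ψ has stable orbits, then for every compact set K ⊆ X there exists a compact set L ⊆ X containing K such that for every m ∈ ℕ and every continuous function f : X → 𝕂 one has sup_{x∈K} |w(x)·w(ψ(x))⋯w(ψ^{m-1}(x))·f(ψ^m(x))| ≤ (sup_{y∈L}|w(y)|)^m · sup_{y∈L}|f(y)|. In particular, the weighted composition operator C_{w,ψ} is m-topologizable on C(X) with the compact-open topology. -/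
open scoped BigOperators

theorem le_biSup_norm_of_compact {X : Type*} [TopologicalSpace X] {𝕂 : Type*} [RCLike 𝕂]
    {L : Set X} (hL : IsCompact L) {g : X → 𝕂} (hg : Continuous g) {y : X} (hy : y ∈ L) :
    ‖g y‖ ≤ ⨆ y ∈ L, ‖g y‖ := by
  obtain ⟨C, hC⟩ := hL.exists_bound_of_continuousOn hg.continuousOn
  have hb : BddAbove (Set.range fun y => ⨆ (_ : y ∈ L), ‖g y‖) := by
    refine ⟨max C 0, ?_⟩
    rintro _ ⟨z, rfl⟩
    exact Real.iSup_le (fun hz => (hC z hz).trans (le_max_left _ _)) (le_max_right _ _)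
  refine le_trans (le_of_eq ?_) (le_ciSup hb y)
  simp [hy]

theorem biSup_norm_nonneg {X : Type*} {𝕂 : Type*} [RCLike 𝕂] (L : Set X) (g : X → 𝕂) :
    0 ≤ ⨆ y ∈ L, ‖g y‖ :=
  Real.iSup_nonneg fun _ => Real.iSup_nonneg fun _ => norm_nonneg _

/-- If `ψ` has stable orbits then the weighted composition operator
`C_{w,ψ}` satisfies, for every compact `K`, the estimate
`sup_{x∈K} ‖(∏_{j<m} w(ψ^j x)) · f(ψ^m x)‖ ≤ (sup_L ‖w‖)^m · sup_L ‖f‖`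
for a suitable compact `L ⊇ K`; in particular `C_{w,ψ}` is m-topologizable on `C(X)`. -/
theorem weighted_composition_m_topologizable_of_stable_orbits
    {X : Type*} [TopologicalSpace X] {𝕂 : Type*} [RCLike 𝕂]
    (w : X → 𝕂) (ψ : X → X) (hw : Continuous w) (hψ : Continuous ψ)
    (hstable : ∀ K : Set X, IsCompact K → ∃ L : Set X, IsCompact L ∧
      ∀ m : ℕ, 1 ≤ m → ψ^[m] '' K ⊆ L) :
    (∀ K : Set X, IsCompact K → ∃ L : Set X, IsCompact L ∧ K ⊆ L ∧
      ∀ m : ℕ, 1 ≤ m → ∀ f : X → 𝕂, Continuous f →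
        (⨆ x ∈ K, ‖(∏ j ∈ Finset.range m, w (ψ^[j] x)) * f (ψ^[m] x)‖) ≤
          (⨆ y ∈ L, ‖w y‖) ^ m * ⨆ y ∈ L, ‖f y‖) ∧
    (∀ K : Set X, IsCompact K → ∃ L : Set X, IsCompact L ∧ ∃ γ : ℝ, 0 < γ ∧
      ∀ m : ℕ, 1 ≤ m → ∀ f : X → 𝕂, Continuous f →
        (⨆ x ∈ K, ‖(∏ j ∈ Finset.range m, w (ψ^[j] x)) * f (ψ^[m] x)‖) ≤
          γ ^ m * ⨆ y ∈ L, ‖f y‖) := by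
  have key : ∀ K : Set X, IsCompact K → ∃ L : Set X, IsCompact L ∧ K ⊆ L ∧
      ∀ m : ℕ, 1 ≤ m → ∀ f : X → 𝕂, Continuous f →
        (⨆ x ∈ K, ‖(∏ j ∈ Finset.range m, w (ψ^[j] x)) * f (ψ^[m] x)‖) ≤
          (⨆ y ∈ L, ‖w y‖) ^ m * ⨆ y ∈ L, ‖f y‖ := by
    intro K hK
    obtain ⟨L, hL, hKL⟩ := hstable K hK
    have hc : IsCompact (K ∪ L) := hK.union hL
    have horb : ∀ x ∈ K, ∀ j : ℕ, ψ^[j] x ∈ K ∪ L := by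
      intro x hx j
      rcases Nat.eq_zero_or_pos j with rfl | hj
      · exact Or.inl hx
      · exact Or.inr (hKL j hj ⟨x, hx, rfl⟩)
    refine ⟨K ∪ L, hc, Set.subset_union_left, fun m _ f hf => ?_⟩
    have hW := biSup_norm_nonneg (K ∪ L) w
    have hF := biSup_norm_nonneg (K ∪ L) f
    have h0 := mul_nonneg (pow_nonneg hW m) hF
    refine Real.iSup_le (fun x => Real.iSup_le (fun hx => ?_) h0) h0
    rw [norm_mul, norm_prod]
    refine mul_le_mul ?_ (le_biSup_norm_of_compact hc hf (horb x hx m)) (norm_nonneg _)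
      (pow_nonneg hW m)
    calc ∏ j ∈ Finset.range m, ‖w (ψ^[j] x)‖
        ≤ ∏ _j ∈ Finset.range m, (⨆ y ∈ K ∪ L, ‖w y‖) :=
          Finset.prod_le_prod (fun _ _ => norm_nonneg _)
            (fun j _ => le_biSup_norm_of_compact hc hw (horb x hx j))
      _ = _ := by rw [Finset.prod_const, Finset.card_range]
  refine ⟨key, fun K hK => ?_⟩
  obtain ⟨L, hL, -, h⟩ := key K hK
  have hW := biSup_norm_nonneg L w
  refine ⟨L, hL, (⨆ y ∈ L, ‖w y‖) + 1, by linarith, fun m hm f hf => (h m hm f hf).trans ?_⟩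
  exact mul_le_mul_of_nonneg_right (pow_le_pow_left₀ hW (by linarith) m)
    (biSup_norm_nonneg L f)
end

section
/- Let Ω be a locally compact, σ-compact, non-compact Hausdorff space, X ⊆ Ω open, 𝕂 ∈ {ℝ, ℂ}, w : X → 𝕂 continuous and ψ : X → X continuous such that for every m ∈ ℕ₀ the set {y ∈ X : w(ψ^m(y)) ≠ 0} is dense in X. If C_{w,ψ} is topologizable on C(X), i.e., for every compact K ⊆ X there is a compact L ⊆ X such that for every m ∈ ℕ there is γ_m > 0 with ‖C_{w,ψ}^m(f)‖_K ≤ γ_m ‖f‖_L for all f ∈ C(X), then ψ has stable orbits. -/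
open scoped BigOperators

/-- On an open subset `X` of a locally compact, σ-compact, non-compact
Hausdorff space, if the weighted composition operator `C_{w,ψ}` is topologizable on `C(X)`
(with the compact-open topology) and all the sets `{y ∈ X | w(ψ^m(y)) ≠ 0}` are dense in
`X`, then `ψ` has stable orbits. -/
theorem stable_orbits_of_topologizable
    {Ω : Type*} [TopologicalSpace Ω] [T2Space Ω] [LocallyCompactSpace Ω]
    [SigmaCompactSpace Ω] [NoncompactSpace Ω] {𝕂 : Type*} [RCLike 𝕂]
    (X : Set Ω) (hX : IsOpen X)
    (w : Ω → 𝕂) (hw : ContinuousOn w X)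
    (ψ : Ω → Ω) (hψ : ContinuousOn ψ X) (hψX : Set.MapsTo ψ X X)
    (hdense : ∀ m : ℕ, X ⊆ closure {y ∈ X | w (ψ^[m] y) ≠ 0})
    (htop : ∀ K : Set Ω, IsCompact K → K ⊆ X →
      ∃ L : Set Ω, IsCompact L ∧ L ⊆ X ∧ ∀ m : ℕ, 1 ≤ m → ∃ γ : ℝ, 0 < γ ∧
        ∀ f : Ω → 𝕂, ContinuousOn f X →
          (⨆ x ∈ K, ‖(∏ j ∈ Finset.range m, w (ψ^[j] x)) * f (ψ^[m] x)‖) ≤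
            γ * ⨆ y ∈ L, ‖f y‖) :
    ∀ K : Set Ω, IsCompact K → K ⊆ X →
      ∃ L : Set Ω, IsCompact L ∧ L ⊆ X ∧ ∀ m : ℕ, 1 ≤ m → ψ^[m] '' K ⊆ L := by
  intro K hK hKX
  have hit : ∀ m : ℕ, ContinuousOn (ψ^[m]) X := fun m => hψ.iterate hψX m
  have hwit : ∀ m : ℕ, ContinuousOn (fun y => w (ψ^[m] y)) X := fun m =>
    hw.comp (hit m) (hψX.iterate m)
  obtain ⟨K', hK', hKK', hK'X⟩ := exists_compact_between hK hX hKX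
  obtain ⟨L, hL, hLX, h⟩ := htop K' hK' hK'X
  refine ⟨L, hL, hLX, ?_⟩
  rintro m hm _ ⟨x, hx, rfl⟩
  by_contra hxL
  obtain ⟨γ, hγ, hf⟩ := h m hm
  have hIX : interior K' ⊆ X := interior_subset.trans hK'X
  have key : ∀ n : ℕ, ∃ V : Set Ω, IsOpen V ∧ V.Nonempty ∧
      V ⊆ interior K' ∩ (ψ^[m]) ⁻¹' Lᶜ ∧ ∀ y ∈ V, ∀ j < n, w (ψ^[j] y) ≠ 0 := by
    intro n
    induction n with
    | zero =>
      exact ⟨_, ((hit m).mono hIX).isOpen_inter_preimage isOpen_interior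
        hL.isClosed.isOpen_compl, ⟨x, hKK' hx, hxL⟩, subset_rfl, by simp⟩
    | succ n ih =>
      obtain ⟨V, hVo, ⟨z, hz⟩, hVs, hV⟩ := ih
      have hVX : V ⊆ X := fun y hy => hIX (hVs hy).1
      obtain ⟨y, hyV, -, hy⟩ := mem_closure_iff.1 (hdense n (hVX hz)) V hVo hz
      refine ⟨V ∩ (fun y => w (ψ^[n] y)) ⁻¹' {0}ᶜ,
        ((hwit n).mono hVX).isOpen_inter_preimage hVo isOpen_compl_singleton,
        ⟨y, hyV, hy⟩, Set.inter_subset_left.trans hVs, ?_⟩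
      rintro u ⟨hu, hu'⟩ j hj
      rcases Nat.lt_succ_iff_lt_or_eq.1 hj with hj | rfl
      · exact hV u hu j hj
      · exact hu'
  obtain ⟨V, -, ⟨y, hyV⟩, hVs, hV⟩ := key m
  obtain ⟨hyK, hyL⟩ := hVs hyV
  obtain ⟨f, hf0, hf1, -⟩ := exists_continuous_zero_one_of_isCompact hL
    (isClosed_singleton (x := ψ^[m] y)) (Set.disjoint_singleton_right.2 hyL)
  have hfc : Continuous (fun u => ((f u : ℝ) : 𝕂)) := RCLike.continuous_ofReal.comp f.continuous
  have H := hf (fun u => ((f u : ℝ) : 𝕂)) hfc.continuousOn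
  have hR : (⨆ u ∈ L, ‖((f u : ℝ) : 𝕂)‖) = 0 := by
    have : ∀ u, (⨆ (_ : u ∈ L), ‖((f u : ℝ) : 𝕂)‖) = 0 := by
      intro u
      by_cases hu : u ∈ L
      · have := hf0 hu
        simp_all
      · simp [hu]
    simp only [this]
    simp
  rw [hR, mul_zero] at H
  set g : Ω → ℝ := fun x => ‖(∏ j ∈ Finset.range m, w (ψ^[j] x)) * ((f (ψ^[m] x) : ℝ) : 𝕂)‖ with hg
  have hgc : ContinuousOn g K' := by
    refine ContinuousOn.norm (ContinuousOn.mul ?_ ?_)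
    · exact continuousOn_finsetProd _ fun j _ => (hwit j).mono hK'X
    · exact hfc.comp_continuousOn ((hit m).mono hK'X)
  obtain ⟨C, hC⟩ := hK'.bddAbove_image hgc
  have hbdd : BddAbove (Set.range fun x => ⨆ (_ : x ∈ K'), g x) := by
    refine ⟨max C 0, ?_⟩
    rintro _ ⟨u, rfl⟩
    by_cases hu : u ∈ K'
    · simp only [hu, ciSup_unique]
      exact (hC ⟨u, hu, rfl⟩).trans (le_max_left _ _)
    · simp [hu]
  have h1 := le_ciSup hbdd y
  simp only [interior_subset hyK, ciSup_unique] at h1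
  have h2 : 0 < g y := by
    have e : f (ψ^[m] y) = 1 := hf1 rfl
    simp only [hg, e, RCLike.ofReal_one, mul_one]
    exact norm_pos_iff.2 (Finset.prod_ne_zero_iff.2 fun j hj => hV y hyV j (Finset.mem_range.1 hj))
  exact absurd (h2.trans_le (h1.trans H)) (lt_irrefl _)
end

section
/- Let Ω be a locally compact, σ-compact, non-compact Hausdorff space, X ⊆ Ω open, 𝕂 ∈ {ℝ, ℂ}, w : X → 𝕂 continuous with {x ∈ X : w(x) ≠ 0} dense in X, and ψ : X → X continuous such that every x ∈ X has an open neighborhood on which ψ is injective and open. Then the following are equivalent: (i) C_{w,ψ} is power bounded on C(X), i.e., for every compact K ⊆ X there exist a compact L ⊆ X and C > 0 with ‖C_{w,ψ}^m(f)‖_K ≤ C‖f‖_L for all m ∈ ℕ and all f ∈ C(X); (ii) C_{w,ψ} is m-topologizable on C(X) (for every compact K there exist a compact L and γ > 0 with ‖C_{w,ψ}^m(f)‖_K ≤ γ^m ‖f‖_L for all m, f) and the set {C_{w,ψ}^m(w) : m ∈ ℕ} is bounded in C(X), i.e., sup_{m∈ℕ} ‖C_{w,ψ}^m(w)‖_K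 < ∞ for every compact K ⊆ X; (iii) ψ has stable orbits and {C_{w,ψ}^m(w) : m ∈ ℕ} is bounded in C(X). -/
open scoped BigOperators

lemma aux_le_biSup {Ω : Type*} {g : Ω → ℝ} {K : Set Ω} {B : ℝ} (h0 : ∀ x, 0 ≤ g x)
    (hB : ∀ x ∈ K, g x ≤ B) {x : Ω} (hx : x ∈ K) : g x ≤ ⨆ y ∈ K, g y := by
  have hb : BddAbove (Set.range fun y => ⨆ _ : y ∈ K, g y) := by
    refine ⟨max B 0, ?_⟩
    rintro _ ⟨y, rfl⟩
    exact Real.iSup_le (fun hy => (hB y hy).trans (le_max_left _ _)) (le_max_right _ _)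
  refine le_trans ?_ (le_ciSup hb x)
  simp [hx]

lemma aux_biSup_le {Ω : Type*} {g : Ω → ℝ} {K : Set Ω} {B : ℝ} (hB0 : 0 ≤ B)
    (hB : ∀ x ∈ K, g x ≤ B) : ⨆ y ∈ K, g y ≤ B :=
  Real.iSup_le (fun y => Real.iSup_le (fun hy => hB y hy) hB0) hB0

lemma aux_biSup_nonneg {Ω : Type*} {g : Ω → ℝ} {K : Set Ω} (h0 : ∀ x, 0 ≤ g x) :
    0 ≤ ⨆ y ∈ K, g y :=
  Real.iSup_nonneg (fun y => Real.iSup_nonneg (fun _ => h0 y))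

lemma aux_dense {Ω : Type*} [TopologicalSpace Ω] {𝕂 : Type*} [RCLike 𝕂]
    (X : Set Ω) (hX : IsOpen X)
    (w : Ω → 𝕂) (hw : ContinuousOn w X)
    (hwdense : X ⊆ closure {x ∈ X | w x ≠ 0})
    (ψ : Ω → Ω) (hψX : Set.MapsTo ψ X X)
    (hloc : ∀ x ∈ X, ∃ U : Set Ω, IsOpen U ∧ x ∈ U ∧ U ⊆ X ∧ Set.InjOn ψ U ∧
      ∀ V : Set Ω, IsOpen V → V ⊆ U → IsOpen (ψ '' V)) (m : ℕ) :
    ∀ V : Set Ω, IsOpen V → V ⊆ X → V.Nonempty →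
      ∃ y ∈ V, (∏ j ∈ Finset.range m, w (ψ^[j] y)) ≠ 0 := by
  induction m with
  | zero => rintro V - - ⟨y, hy⟩; exact ⟨y, hy, by simp⟩
  | succ m ih =>
    rintro V hV hVX ⟨x0, hx0⟩
    obtain ⟨x, hxV, hxX, hwx⟩ := mem_closure_iff.1 (hwdense (hVX hx0)) V hV hx0
    obtain ⟨U, hU, hxU, hUX, -, hop⟩ := hloc x hxX
    have hW : IsOpen (X ∩ w ⁻¹' {0}ᶜ) :=
      hw.isOpen_inter_preimage hX isOpen_compl_singleton
    obtain ⟨z, ⟨y, hy, rfl⟩, hz⟩ := ih (ψ '' (U ∩ (V ∩ (X ∩ w ⁻¹' {0}ᶜ))))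
      (hop _ (hU.inter (hV.inter hW)) Set.inter_subset_left)
      (by rintro _ ⟨y, hy, rfl⟩; exact hψX (hUX hy.1))
      ⟨ψ x, x, ⟨hxU, hxV, hxX, hwx⟩, rfl⟩
    refine ⟨y, hy.2.1, ?_⟩
    rw [Finset.prod_range_succ']
    exact mul_ne_zero hz hy.2.2.2

/-- Characterization of power boundedness of a weighted composition
operator on `C(X)` with the compact-open topology: power boundedness is equivalent to
m-topologizability together with boundedness of the orbit `{C_{w,ψ}^m(w)}`, and also to
`ψ` having stable orbits together with boundedness of `{C_{w,ψ}^m(w)}`. -/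
theorem power_bounded_characterization_continuous
    {Ω : Type*} [TopologicalSpace Ω] [T2Space Ω] [LocallyCompactSpace Ω]
    [SigmaCompactSpace Ω] [NoncompactSpace Ω] {𝕂 : Type*} [RCLike 𝕂]
    (X : Set Ω) (hX : IsOpen X)
    (w : Ω → 𝕂) (hw : ContinuousOn w X)
    (hwdense : X ⊆ closure {x ∈ X | w x ≠ 0})
    (ψ : Ω → Ω) (hψ : ContinuousOn ψ X) (hψX : Set.MapsTo ψ X X)
    (hloc : ∀ x ∈ X, ∃ U : Set Ω, IsOpen U ∧ x ∈ U ∧ U ⊆ X ∧ Set.InjOn ψ U ∧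
      ∀ V : Set Ω, IsOpen V → V ⊆ U → IsOpen (ψ '' V)) :
    -- (i) power bounded
    ((∀ K : Set Ω, IsCompact K → K ⊆ X →
        ∃ L : Set Ω, IsCompact L ∧ L ⊆ X ∧ ∃ C : ℝ, 0 < C ∧
          ∀ m : ℕ, 1 ≤ m → ∀ f : Ω → 𝕂, ContinuousOn f X →
            (⨆ x ∈ K, ‖(∏ j ∈ Finset.range m, w (ψ^[j] x)) * f (ψ^[m] x)‖) ≤
              C * ⨆ y ∈ L, ‖f y‖) ↔
    -- (ii) m-topologizable and {C_{w,ψ}^m(w)} bounded in C(X)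
      ((∀ K : Set Ω, IsCompact K → K ⊆ X →
        ∃ L : Set Ω, IsCompact L ∧ L ⊆ X ∧ ∃ γ : ℝ, 0 < γ ∧
          ∀ m : ℕ, 1 ≤ m → ∀ f : Ω → 𝕂, ContinuousOn f X →
            (⨆ x ∈ K, ‖(∏ j ∈ Finset.range m, w (ψ^[j] x)) * f (ψ^[m] x)‖) ≤
              γ ^ m * ⨆ y ∈ L, ‖f y‖) ∧
       (∀ K : Set Ω, IsCompact K → K ⊆ X → ∃ M : ℝ, ∀ m : ℕ, 1 ≤ m → ∀ x ∈ K,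
          ‖(∏ j ∈ Finset.range m, w (ψ^[j] x)) * w (ψ^[m] x)‖ ≤ M))) ∧
    -- (ii) ↔ (iii) stable orbits and {C_{w,ψ}^m(w)} bounded in C(X)
    (((∀ K : Set Ω, IsCompact K → K ⊆ X →
        ∃ L : Set Ω, IsCompact L ∧ L ⊆ X ∧ ∃ γ : ℝ, 0 < γ ∧
          ∀ m : ℕ, 1 ≤ m → ∀ f : Ω → 𝕂, ContinuousOn f X →
            (⨆ x ∈ K, ‖(∏ j ∈ Finset.range m, w (ψ^[j] x)) * f (ψ^[m] x)‖) ≤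
              γ ^ m * ⨆ y ∈ L, ‖f y‖) ∧
      (∀ K : Set Ω, IsCompact K → K ⊆ X → ∃ M : ℝ, ∀ m : ℕ, 1 ≤ m → ∀ x ∈ K,
          ‖(∏ j ∈ Finset.range m, w (ψ^[j] x)) * w (ψ^[m] x)‖ ≤ M)) ↔
     ((∀ K : Set Ω, IsCompact K → K ⊆ X →
        ∃ L : Set Ω, IsCompact L ∧ L ⊆ X ∧ ∀ m : ℕ, 1 ≤ m → ψ^[m] '' K ⊆ L) ∧
      (∀ K : Set Ω, IsCompact K → K ⊆ X → ∃ M : ℝ, ∀ m : ℕ, 1 ≤ m → ∀ x ∈ K,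
          ‖(∏ j ∈ Finset.range m, w (ψ^[j] x)) * w (ψ^[m] x)‖ ≤ M))) := by
  have hiterX : ∀ m : ℕ, Set.MapsTo (ψ^[m]) X X := fun m => hψX.iterate m
  have hiter : ∀ m : ℕ, ContinuousOn (ψ^[m]) X := fun m => hψ.iterate hψX m
  have hprod : ∀ m : ℕ, ContinuousOn (fun x => ∏ j ∈ Finset.range m, w (ψ^[j] x)) X := fun m =>
    continuousOn_finsetProd _ fun j _ => hw.comp (hiter j) (hiterX j)
  have hval : ∀ K : Set Ω, IsCompact K → K ⊆ X → ∀ m : ℕ, ∀ f : Ω → 𝕂, ContinuousOn f X →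
      ∀ x ∈ K, ‖(∏ j ∈ Finset.range m, w (ψ^[j] x)) * f (ψ^[m] x)‖ ≤
        ⨆ x ∈ K, ‖(∏ j ∈ Finset.range m, w (ψ^[j] x)) * f (ψ^[m] x)‖ := by
    intro K hK hKX m f hf x hx
    have hc : ContinuousOn (fun x => (∏ j ∈ Finset.range m, w (ψ^[j] x)) * f (ψ^[m] x)) K :=
      ((hprod m).mul (hf.comp (hiter m) (hiterX m))).mono hKX
    obtain ⟨B, hB⟩ := hK.exists_bound_of_continuousOn hc
    exact aux_le_biSup (g := fun x => ‖(∏ j ∈ Finset.range m, w (ψ^[j] x)) * f (ψ^[m] x)‖)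
      (fun _ => norm_nonneg _) hB hx
  have h12 : (∀ K : Set Ω, IsCompact K → K ⊆ X →
        ∃ L : Set Ω, IsCompact L ∧ L ⊆ X ∧ ∃ C : ℝ, 0 < C ∧
          ∀ m : ℕ, 1 ≤ m → ∀ f : Ω → 𝕂, ContinuousOn f X →
            (⨆ x ∈ K, ‖(∏ j ∈ Finset.range m, w (ψ^[j] x)) * f (ψ^[m] x)‖) ≤
              C * ⨆ y ∈ L, ‖f y‖) →
      ((∀ K : Set Ω, IsCompact K → K ⊆ X →
        ∃ L : Set Ω, IsCompact L ∧ L ⊆ X ∧ ∃ γ : ℝ, 0 < γ ∧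
          ∀ m : ℕ, 1 ≤ m → ∀ f : Ω → 𝕂, ContinuousOn f X →
            (⨆ x ∈ K, ‖(∏ j ∈ Finset.range m, w (ψ^[j] x)) * f (ψ^[m] x)‖) ≤
              γ ^ m * ⨆ y ∈ L, ‖f y‖) ∧
       (∀ K : Set Ω, IsCompact K → K ⊆ X → ∃ M : ℝ, ∀ m : ℕ, 1 ≤ m → ∀ x ∈ K,
          ‖(∏ j ∈ Finset.range m, w (ψ^[j] x)) * w (ψ^[m] x)‖ ≤ M)) := by
    intro h
    constructor
    · intro K hK hKX
      obtain ⟨L, hL, hLX, C, hC, hb⟩ := h K hK hKX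
      refine ⟨L, hL, hLX, max C 1, lt_max_of_lt_left hC, fun m hm f hf => (hb m hm f hf).trans ?_⟩
      refine mul_le_mul_of_nonneg_right ?_ (aux_biSup_nonneg fun _ => norm_nonneg _)
      exact (le_max_left C 1).trans (le_self_pow₀ (le_max_right C 1) (by omega))
    · intro K hK hKX
      obtain ⟨L, hL, hLX, C, hC, hb⟩ := h K hK hKX
      exact ⟨_, fun m hm x hx => (hval K hK hKX m w hw x hx).trans (hb m hm w hw)⟩
  have h23 : (∀ K : Set Ω, IsCompact K → K ⊆ X →
        ∃ L : Set Ω, IsCompact L ∧ L ⊆ X ∧ ∃ γ : ℝ, 0 < γ ∧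
          ∀ m : ℕ, 1 ≤ m → ∀ f : Ω → 𝕂, ContinuousOn f X →
            (⨆ x ∈ K, ‖(∏ j ∈ Finset.range m, w (ψ^[j] x)) * f (ψ^[m] x)‖) ≤
              γ ^ m * ⨆ y ∈ L, ‖f y‖) →
      (∀ K : Set Ω, IsCompact K → K ⊆ X →
        ∃ L : Set Ω, IsCompact L ∧ L ⊆ X ∧ ∀ m : ℕ, 1 ≤ m → ψ^[m] '' K ⊆ L) := by
    intro h K hK hKX
    obtain ⟨K', hK', hKK', hK'X⟩ := exists_compact_between hK hX hKX
    obtain ⟨L, hL, hLX, γ, hγ, hb⟩ := h K' hK' hK'X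
    refine ⟨L, hL, hLX, fun m hm => ?_⟩
    rintro _ ⟨x, hx, rfl⟩
    by_contra hxL
    have hVo : IsOpen (X ∩ ψ^[m] ⁻¹' Lᶜ) :=
      (hiter m).isOpen_inter_preimage hX hL.isClosed.isOpen_compl
    obtain ⟨y, ⟨hyK, hyX, hyL⟩, hy⟩ := aux_dense X hX w hw hwdense ψ hψX hloc m
      (interior K' ∩ (X ∩ ψ^[m] ⁻¹' Lᶜ)) (isOpen_interior.inter hVo)
      (fun z hz => hz.2.1) ⟨x, hKK' hx, hKX hx, hxL⟩
    obtain ⟨f, hf0, hf1, -⟩ := exists_continuous_zero_one_of_isCompact hL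
      (isClosed_singleton (x := ψ^[m] y)) (Set.disjoint_singleton_right.2 hyL)
    have hfc : Continuous (fun z => ((f z : ℝ) : 𝕂)) := RCLike.continuous_ofReal.comp f.continuous
    have h1 := (hval K' hK' hK'X m (fun z => ((f z : ℝ) : 𝕂)) hfc.continuousOn y
      (interior_subset hyK)).trans (hb m hm _ hfc.continuousOn)
    have h2 : (⨆ z ∈ L, ‖((f z : ℝ) : 𝕂)‖) ≤ 0 :=
      aux_biSup_le (g := fun z => ‖((f z : ℝ) : 𝕂)‖) le_rfl (fun z hz => by
        have := hf0 hz
        simp at this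
        simp [this])
    have h3 := h1.trans (mul_nonpos_of_nonneg_of_nonpos (pow_pos hγ m).le h2)
    have h4 : f (ψ^[m] y) = 1 := hf1 rfl
    rw [norm_le_zero_iff] at h3
    simp only [h4, RCLike.ofReal_one, mul_one] at h3
    exact hy h3
  have h31 : (∀ K : Set Ω, IsCompact K → K ⊆ X →
        ∃ L : Set Ω, IsCompact L ∧ L ⊆ X ∧ ∀ m : ℕ, 1 ≤ m → ψ^[m] '' K ⊆ L) →
      (∀ K : Set Ω, IsCompact K → K ⊆ X → ∃ M : ℝ, ∀ m : ℕ, 1 ≤ m → ∀ x ∈ K,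
          ‖(∏ j ∈ Finset.range m, w (ψ^[j] x)) * w (ψ^[m] x)‖ ≤ M) →
      (∀ K : Set Ω, IsCompact K → K ⊆ X →
        ∃ L : Set Ω, IsCompact L ∧ L ⊆ X ∧ ∃ C : ℝ, 0 < C ∧
          ∀ m : ℕ, 1 ≤ m → ∀ f : Ω → 𝕂, ContinuousOn f X →
            (⨆ x ∈ K, ‖(∏ j ∈ Finset.range m, w (ψ^[j] x)) * f (ψ^[m] x)‖) ≤
              C * ⨆ y ∈ L, ‖f y‖) := by
    intro hs hbd K hK hKX
    obtain ⟨L, hL, hLX, hmL⟩ := hs K hK hKX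
    obtain ⟨M, hM⟩ := hbd K hK hKX
    obtain ⟨B, hB⟩ := hK.exists_bound_of_continuousOn (hw.mono hKX)
    have hC : 0 < max (max M B) 1 := lt_max_of_lt_right one_pos
    refine ⟨L, hL, hLX, max (max M B) 1, hC, fun m hm f hf => ?_⟩
    have h0 : 0 ≤ ⨆ y ∈ L, ‖f y‖ := aux_biSup_nonneg fun _ => norm_nonneg _
    refine aux_biSup_le (mul_nonneg hC.le h0) fun x hx => ?_
    rw [norm_mul]
    refine mul_le_mul ?_ ?_ (norm_nonneg _) hC.le
    · refine le_trans ?_ (le_max_left _ _)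
      obtain ⟨n, rfl⟩ : ∃ n, m = n + 1 := ⟨m - 1, by omega⟩
      rcases Nat.eq_zero_or_pos n with rfl | hn
      · simpa using Or.inr (hB x hx)
      · rw [Finset.prod_range_succ]
        exact (hM n hn x hx).trans (le_max_left _ _)
    · obtain ⟨B', hB'⟩ := hL.exists_bound_of_continuousOn (hf.mono hLX)
      exact aux_le_biSup (g := fun y => ‖f y‖) (fun _ => norm_nonneg _) hB'
        (hmL m hm ⟨x, hx, rfl⟩)
  exact ⟨⟨h12, fun h => h31 (h23 h.1) h.2⟩,
    ⟨fun h => ⟨h23 h.1, h.2⟩, fun h => h12 (h31 h.1 h.2)⟩⟩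
end

section
/- Let X ⊆ ℝ^d be open, 𝕂 ∈ {ℝ, ℂ}, w ∈ C^∞(X) with {x ∈ X : w(x) ≠ 0} dense in X, and let ψ : X → X be smooth and locally injective. Then C_{w,ψ} is topologizable on C^∞(X) (i.e., for every l ∈ ℕ₀ and compact K ⊆ X there are l' ∈ ℕ₀ and a compact L ⊆ X such that for every m ∈ ℕ there is γ_m > 0 with ‖C_{w,ψ}^m(f)‖_{l,K} ≤ γ_m ‖f‖_{l',L} for all f ∈ C^∞(X)) if and only if ψ has stable orbits. -/
open scoped BigOperators

noncomputable section

/-- Partial derivative in the `i`-th coordinate direction. -/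
def pderivE {d : ℕ} {F : Type*} [NormedAddCommGroup F] [NormedSpace ℝ F] (i : Fin d)
    (f : EuclideanSpace ℝ (Fin d) → F) : EuclideanSpace ℝ (Fin d) → F :=
  fun x => fderiv ℝ f x (EuclideanSpace.single i 1)

/-- Iterated partial derivative `∂^α f` for a multi-index `α : Fin d → ℕ`. -/
def mderivE {d : ℕ} {F : Type*} [NormedAddCommGroup F] [NormedSpace ℝ F] (α : Fin d → ℕ)
    (f : EuclideanSpace ℝ (Fin d) → F) : EuclideanSpace ℝ (Fin d) → F :=
  (List.finRange d).foldr (fun i g => (pderivE i)^[α i] g) f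

/-- The seminorm `‖f‖_{l,K} = max_{|α| ≤ l} sup_{x ∈ K} ‖∂^α f (x)‖` of the space
`C^∞(X)` of smooth functions. -/
def cSemiNorm {d : ℕ} {F : Type*} [NormedAddCommGroup F] [NormedSpace ℝ F] (l : ℕ)
    (K : Set (EuclideanSpace ℝ (Fin d))) (f : EuclideanSpace ℝ (Fin d) → F) : ℝ :=
  ⨆ α : Fin d → ℕ, ⨆ (_ : (∑ i, α i) ≤ l), ⨆ x ∈ K, ‖mderivE α f x‖

section aux

open Set Filter Topology

section geom
variable {E : Type*} [NormedAddCommGroup E] [NormedSpace ℝ E] [FiniteDimensional ℝ E]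

lemma gen_inverse (A : E →ₗ[ℝ] E) : ∃ S : E →ₗ[ℝ] E, ∀ x, A (S (A x)) = A x := by
  obtain ⟨g, hg⟩ := A.rangeRestrict.exists_rightInverse_of_surjective A.range_rangeRestrict
  obtain ⟨S, hS⟩ := LinearMap.exists_extend g
  refine ⟨S, fun x => ?_⟩
  have h1 : S (A x) = g (A.rangeRestrict x) := by
    rw [← hS]; rfl
  have h2 := LinearMap.congr_fun hg (A.rangeRestrict x)
  rw [h1]
  exact congrArg Subtype.val h2

lemma ker_core (A0 S A B : E →ₗ[ℝ] E) (hS : ∀ x, A0 (S (A0 x)) = A0 x)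
    (hB : ∀ x, B x = S (A0 (S (A x))) + (x - S (A0 x)))
    (hsurj : Function.Surjective B)
    (hr : Module.finrank ℝ (LinearMap.range A) ≤ Module.finrank ℝ (LinearMap.range A0))
    (v v0 : E) (hv0 : A0 v0 = 0) (hv : B v = v0) : A v = 0 := by
  set M : E →ₗ[ℝ] E := A0 ∘ₗ B with hM
  have hM' : ∀ x, M x = A0 (S (A x)) := by
    intro x
    simp only [hM, LinearMap.comp_apply, hB, map_add, map_sub, hS, sub_self, add_zero]
  have hrange : LinearMap.range M = LinearMap.range A0 :=
    LinearMap.range_comp_of_range_eq_top _ (LinearMap.range_eq_top.2 hsurj)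
  have hle : LinearMap.ker A ≤ LinearMap.ker M := by
    intro x hx
    rw [LinearMap.mem_ker] at hx ⊢
    rw [hM', hx]; simp
  have e1 := M.finrank_range_add_finrank_ker
  have e2 := A.finrank_range_add_finrank_ker
  rw [hrange] at e1
  have heq := Submodule.eq_of_le_of_finrank_le hle (by omega)
  have : v ∈ LinearMap.ker M := by
    rw [LinearMap.mem_ker, hM, LinearMap.comp_apply, hv, hv0]
  rw [← heq] at this
  exact this

lemma exists_nhds_image {V : Set E} (hV : IsOpen V) (hne : V.Nonempty) {ψ : E → E}
    (hψ : ContDiffOn ℝ (⊤ : ℕ∞) ψ V) (hinj : InjOn ψ V) :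
    ∃ x ∈ V, ψ '' V ∈ 𝓝 (ψ x) := by
  have : CompleteSpace E := FiniteDimensional.complete ℝ E
  -- a point of maximal rank
  let rk : E → ℕ := fun x => Module.finrank ℝ (LinearMap.range (fderiv ℝ ψ x : E →ₗ[ℝ] E))
  obtain ⟨x0, hx0, hmax⟩ : ∃ x0 ∈ V, ∀ x ∈ V, rk x ≤ rk x0 := by
    have hfin : (rk '' V).Finite :=
      (Set.finite_Iic (Module.finrank ℝ E)).subset (by
        rintro _ ⟨x, -, rfl⟩
        exact Submodule.finrank_le _)
    obtain ⟨_, ⟨⟨x0, hx0, rfl⟩, h⟩⟩ := hfin.exists_maximal (hne.image rk)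
    refine ⟨x0, hx0, fun x hx => ?_⟩
    by_contra hlt
    push Not at hlt
    exact absurd (h ⟨x, hx, rfl⟩ hlt.le) (not_le.2 hlt)
  refine ⟨x0, hx0, ?_⟩
  have hcd : ContDiffAt ℝ (⊤ : ℕ∞) ψ x0 := hψ.contDiffAt (hV.mem_nhds hx0)
  have hstrict : HasStrictFDerivAt ψ (fderiv ℝ ψ x0) x0 := hcd.hasStrictFDerivAt (by simp)
  by_cases hinjA : Function.Injective (fderiv ℝ ψ x0 : E →ₗ[ℝ] E)
  · have hs : Function.Surjective (fderiv ℝ ψ x0 : E →ₗ[ℝ] E) :=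
      LinearMap.injective_iff_surjective.1 hinjA
    rw [← hstrict.map_nhds_eq_of_surj (LinearMap.range_eq_top.2 hs)]
    exact image_mem_map (hV.mem_nhds hx0)
  exfalso
  obtain ⟨v0, hv0, hv0ne⟩ : ∃ v0 : E, fderiv ℝ ψ x0 v0 = 0 ∧ v0 ≠ 0 := by
    by_contra! h
    exact hinjA ((injective_iff_map_eq_zero _).2 (fun a ha => h a ha))
  obtain ⟨S, hS⟩ := gen_inverse (fderiv ℝ ψ x0 : E →ₗ[ℝ] E)
  let Sc : E →L[ℝ] E := S.toContinuousLinearMap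
  let A0 := fderiv ℝ ψ x0
  let B : E → (E →L[ℝ] E) := fun x =>
    (Sc ∘L A0 ∘L Sc) ∘L fderiv ℝ ψ x + (ContinuousLinearMap.id ℝ E - Sc ∘L A0)
  have hB0 : B x0 = 1 := by
    ext x
    have := hS x
    simp only [ContinuousLinearMap.coe_coe] at this
    simp [B, Sc, A0, this]
  have hfd : ContDiffAt ℝ (⊤ : ℕ∞) (fderiv ℝ ψ) x0 := hcd.fderiv_right (by simp)
  have hBc : ContDiffAt ℝ (⊤ : ℕ∞) B x0 :=
    (contDiffAt_const.clm_comp hfd).add contDiffAt_const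
  let v : E → E := fun x => (Ring.inverse (B x)) v0
  have hinvc : ContDiffAt ℝ (⊤ : ℕ∞) (fun x => Ring.inverse (B x)) x0 := by
    have h1 : ContDiffAt ℝ (⊤ : ℕ∞) (Ring.inverse : (E →L[ℝ] E) → (E →L[ℝ] E)) (B x0) := by
      rw [hB0]; exact contDiffAt_ringInverse ℝ (1 : (E →L[ℝ] E)ˣ)
    exact h1.comp x0 hBc
  have hvc : ContDiffAt ℝ 1 v x0 := (hinvc.clm_apply contDiffAt_const).of_le (by
    exact_mod_cast le_top)
  have hv00 : v x0 = v0 := by simp [v, hB0]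
  have hunit : ∀ᶠ x in 𝓝 x0, IsUnit (B x) := by
    apply hBc.continuousAt.eventually
    exact Units.isOpen.mem_nhds (by rw [mem_ofPred_eq, hB0]; exact isUnit_one)
  have hker : ∀ᶠ x in 𝓝 x0, x ∈ V ∧ fderiv ℝ ψ x (v x) = 0 := by
    filter_upwards [hunit, hV.mem_nhds hx0] with x hx hxV
    refine ⟨hxV, ?_⟩
    have hmul : ∀ y, B x (Ring.inverse (B x) y) = y := fun y => by
      have := Ring.mul_inverse_cancel _ hx
      simpa using congrArg (fun T : E →L[ℝ] E => T y) this
    refine ker_core (A0 : E →ₗ[ℝ] E) S (fderiv ℝ ψ x : E →ₗ[ℝ] E) (B x : E →ₗ[ℝ] E) hS ?_ ?_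
      (hmax x hxV) (v x) v0 hv0 (hmul v0)
    · intro y
      simp [B, Sc]
    · intro y
      exact ⟨_, hmul y⟩
  obtain ⟨α, hα0, ε, hε, hα⟩ :=
    hvc.exists_forall_mem_closedBall_exists_eq_forall_mem_Ioo_hasDerivAt₀ 0
  have hα0' : HasDerivAt α (v (α 0)) 0 := hα 0 (by constructor <;> linarith)
  have hev : ∀ᶠ t in 𝓝 (0 : ℝ), α t ∈ V ∧ fderiv ℝ ψ (α t) (v (α t)) = 0 := by
    have hc := hα0'.continuousAt
    rw [ContinuousAt, hα0] at hc
    exact hc.eventually hker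
  obtain ⟨δ, hδ, hball⟩ := Metric.eventually_nhds_iff_ball.1 hev
  set η := min δ ε
  have hη : 0 < η := lt_min hδ hε
  have hd : ∀ t ∈ Metric.ball (0:ℝ) η, HasDerivAt (ψ ∘ α) 0 t := by
    intro t ht
    have htδ := hball t (Metric.ball_subset_ball (min_le_left _ _) ht)
    have htε : t ∈ Ioo (0 - ε) (0 + ε) := by
      have := Metric.ball_subset_ball (min_le_right δ ε) ht
      rwa [Real.ball_eq_Ioo] at this
    have h1 : HasFDerivAt ψ (fderiv ℝ ψ (α t)) (α t) :=
      ((hψ.contDiffAt (hV.mem_nhds htδ.1)).differentiableAt (by simp)).hasFDerivAt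
    have := h1.comp_hasDerivAt t (hα t htε)
    rwa [htδ.2] at this
  have h0m : (0:ℝ) ∈ Metric.ball (0:ℝ) η := Metric.mem_ball_self hη
  have hconst : ∀ t ∈ Metric.ball (0:ℝ) η, α t = x0 := by
    intro t ht
    have := Metric.isOpen_ball.is_const_of_deriv_eq_zero (convex_ball (0:ℝ) η).isPreconnected
      (fun s hs => (hd s hs).differentiableAt.differentiableWithinAt)
      (fun s hs => (hd s hs).deriv) ht h0m
    have h2 := hinj (hball t (Metric.ball_subset_ball (min_le_left _ _) ht)).1
      (hball 0 (Metric.mem_ball_self hδ)).1 this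
    rw [h2, hα0]
  have hz : HasDerivAt α 0 0 := by
    refine (hasDerivAt_const (0:ℝ) x0).congr_of_eventuallyEq ?_
    filter_upwards [Metric.ball_mem_nhds (0:ℝ) hη] with t ht using hconst t ht
  have := hα0'.unique hz
  rw [hα0, hv00] at this
  exact hv0ne this

lemma dense_prod {𝕂 : Type*} [RCLike 𝕂] {X : Set E} {w : E → 𝕂}
    (hw : ContinuousOn w X) (hwdense : X ⊆ closure {x ∈ X | w x ≠ 0}) {ψ : E → E}
    (hψ : ContDiffOn ℝ (⊤ : ℕ∞) ψ X) (hψX : MapsTo ψ X X)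
    (hloc : ∀ x ∈ X, ∃ U : Set E, IsOpen U ∧ x ∈ U ∧ U ⊆ X ∧ InjOn ψ U) (m : ℕ) :
    ∀ V : Set E, IsOpen V → V ⊆ X → V.Nonempty →
      ∃ x ∈ V, (∏ j ∈ Finset.range m, w (ψ^[j] x)) ≠ 0 := by
  induction m with
  | zero => rintro V - - ⟨x, hx⟩; exact ⟨x, hx, by simp⟩
  | succ m ih =>
    rintro V hV hVX ⟨x, hx⟩
    obtain ⟨y, hyV, hyX, hy⟩ := mem_closure_iff.1 (hwdense (hVX hx)) V hV hx
    obtain ⟨U, hU, hyU, hUX, hUi⟩ := hloc y hyX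
    set V1 := (V ∩ U) ∩ w ⁻¹' {0}ᶜ with hV1
    have hV1o : IsOpen V1 :=
      (hw.mono (inter_subset_left.trans hVX)).isOpen_inter_preimage (hV.inter hU)
        isOpen_compl_singleton
    have hV1X : V1 ⊆ X := inter_subset_left.trans (inter_subset_left.trans hVX)
    obtain ⟨z, hz, hzn⟩ := exists_nhds_image hV1o ⟨y, ⟨hyV, hyU⟩, hy⟩ (hψ.mono hV1X)
      (hUi.mono (inter_subset_left.trans inter_subset_right))
    obtain ⟨q, hq, hqne⟩ := ih (interior (ψ '' V1)) isOpen_interior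
      (interior_subset.trans ((image_mono hV1X).trans hψX.image_subset))
      ⟨ψ z, mem_interior_iff_mem_nhds.2 hzn⟩
    obtain ⟨p, hp, rfl⟩ := interior_subset hq
    refine ⟨p, hp.1.1, ?_⟩
    rw [Finset.prod_range_succ']
    exact mul_ne_zero hqne hp.2

end geom

section deriv
variable {d : ℕ} {F : Type*} [NormedAddCommGroup F] [NormedSpace ℝ F]
  {X : Set (EuclideanSpace ℝ (Fin d))}

local notation "EE" => EuclideanSpace ℝ (Fin d)

/-- Iterated partial derivative along a list of directions. -/
def listDeriv (s : List (Fin d)) (f : EuclideanSpace ℝ (Fin d) → F) :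
    EuclideanSpace ℝ (Fin d) → F :=
  s.foldr pderivE f

lemma listDeriv_append (s t : List (Fin d)) (f : EE → F) :
    listDeriv (s ++ t) f = listDeriv s (listDeriv t f) := by
  simp [listDeriv]

lemma listDeriv_cons (i : Fin d) (t : List (Fin d)) (f : EE → F) :
    listDeriv (i :: t) f = pderivE i (listDeriv t f) := rfl

lemma listDeriv_replicate (i : Fin d) (n : ℕ) (f : EE → F) :
    listDeriv (List.replicate n i) f = (pderivE i)^[n] f := by
  induction n with
  | zero => rfl
  | succ n ih => rw [List.replicate_succ, listDeriv_cons, ih, Function.iterate_succ_apply']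

/-- The list of directions of a multi-index. -/
def mlist (α : Fin d → ℕ) : List (Fin d) :=
  (List.finRange d).flatMap fun i => List.replicate (α i) i

lemma mderivE_eq (α : Fin d → ℕ) (f : EE → F) : mderivE α f = listDeriv (mlist α) f := by
  unfold mderivE mlist
  induction List.finRange d with
  | nil => rfl
  | cons i t ih =>
    rw [List.foldr_cons, List.flatMap_cons, listDeriv_append, listDeriv_replicate, ih]

lemma mlist_length (α : Fin d → ℕ) : (mlist α).length = ∑ i, α i := by
  simp [mlist, List.length_flatMap, Fin.sum_univ_def]

lemma mlist_count (α : Fin d → ℕ) (i : Fin d) : (mlist α).count i = α i := by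
  have h : ∀ l : List (Fin d), l.Nodup →
      (l.flatMap fun i => List.replicate (α i) i).count i = if i ∈ l then α i else 0 := by
    intro l
    induction l with
    | nil => simp
    | cons j t ih =>
      intro hn
      rw [List.nodup_cons] at hn
      rw [List.flatMap_cons, List.count_append, ih hn.2, List.count_replicate]
      by_cases hij : i = j
      · subst hij; simp [hn.1]
      · simp [hij, Ne.symm hij]
  simpa [mlist] using h _ (List.nodup_finRange d)

lemma mlist_perm (s : List (Fin d)) : (mlist fun i => s.count i).Perm s := by
  rw [List.perm_iff_count]
  intro i
  rw [mlist_count]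

lemma pderivE_smooth (hX : IsOpen X) {f : EE → F} (hf : ContDiffOn ℝ (⊤ : ℕ∞) f X) (i : Fin d) :
    ContDiffOn ℝ (⊤ : ℕ∞) (pderivE i f) X :=
  (hf.fderiv_of_isOpen hX (by simp)).clm_apply contDiffOn_const

lemma listDeriv_smooth (hX : IsOpen X) {f : EE → F} (hf : ContDiffOn ℝ (⊤ : ℕ∞) f X)
    (s : List (Fin d)) : ContDiffOn ℝ (⊤ : ℕ∞) (listDeriv s f) X := by
  induction s with
  | nil => exact hf
  | cons i t ih => exact pderivE_smooth hX ih i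

lemma pderivE_congr (hX : IsOpen X) {f g : EE → F} (h : EqOn f g X) (i : Fin d) :
    EqOn (pderivE i f) (pderivE i g) X := by
  intro x hx
  have : f =ᶠ[𝓝 x] g := h.eventuallyEq_of_mem (hX.mem_nhds hx)
  simp only [pderivE, this.fderiv_eq]

lemma listDeriv_congr (hX : IsOpen X) {f g : EE → F} (h : EqOn f g X) (s : List (Fin d)) :
    EqOn (listDeriv s f) (listDeriv s g) X := by
  induction s with
  | nil => exact h
  | cons i t ih => exact pderivE_congr hX ih i

lemma sm_diffAt (hX : IsOpen X) {f : EE → F} (hf : ContDiffOn ℝ (⊤ : ℕ∞) f X) {x : EE}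
    (hx : x ∈ X) : DifferentiableAt ℝ f x :=
  (hf.contDiffAt (hX.mem_nhds hx)).differentiableAt (by simp)

lemma pderivE_comm (hX : IsOpen X) {f : EE → F} (hf : ContDiffOn ℝ (⊤ : ℕ∞) f X) (i j : Fin d) :
    EqOn (pderivE i (pderivE j f)) (pderivE j (pderivE i f)) X := by
  intro x hx
  have hd : DifferentiableAt ℝ (fderiv ℝ f) x := sm_diffAt hX (hf.fderiv_of_isOpen hX (by simp)) hx
  have key : ∀ a b : Fin d, pderivE a (pderivE b f) x =
      fderiv ℝ (fderiv ℝ f) x (EuclideanSpace.single a 1) (EuclideanSpace.single b 1) := by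
    intro a b
    unfold pderivE
    rw [fderiv_clm_apply hd (differentiableAt_const _)]
    simp
  rw [key, key]
  have hsym : IsSymmSndFDerivAt ℝ f x :=
    (hf.contDiffAt (hX.mem_nhds hx)).isSymmSndFDerivAt (by
      rw [minSmoothness_of_isRCLikeNormedField]
      exact WithTop.coe_le_coe.2 (le_top : (2 : ℕ∞) ≤ ⊤))
  exact hsym _ _

lemma listDeriv_perm (hX : IsOpen X) {f : EE → F} (hf : ContDiffOn ℝ (⊤ : ℕ∞) f X)
    {s t : List (Fin d)} (h : s.Perm t) : EqOn (listDeriv s f) (listDeriv t f) X := by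
  induction h with
  | nil => exact fun _ _ => rfl
  | cons i _ ih => exact pderivE_congr hX ih i
  | swap i j t => exact pderivE_comm hX (listDeriv_smooth hX hf t) j i
  | trans _ _ h1 h2 => exact h1.trans h2

lemma cSemiNorm_le (l : ℕ) (K : Set EE) (f : EE → F) {M : ℝ} (hM : 0 ≤ M)
    (h : ∀ α : Fin d → ℕ, (∑ i, α i) ≤ l → ∀ x ∈ K, ‖mderivE α f x‖ ≤ M) :
    cSemiNorm l K f ≤ M :=
  Real.iSup_le (fun α => Real.iSup_le (fun hα => Real.iSup_le (fun x =>
    Real.iSup_le (fun hx => h α hα x hx) hM) hM) hM) hM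

lemma cSemiNorm_nonneg (l : ℕ) (K : Set EE) (f : EE → F) : 0 ≤ cSemiNorm l K f :=
  Real.iSup_nonneg fun _ => Real.iSup_nonneg fun _ => Real.iSup_nonneg fun _ =>
    Real.iSup_nonneg fun _ => norm_nonneg _

lemma le_cSemiNorm (hX : IsOpen X) {K : Set EE} (hK : IsCompact K) (hKX : K ⊆ X) {f : EE → F}
    (hf : ContDiffOn ℝ (⊤ : ℕ∞) f X) {l : ℕ} {α : Fin d → ℕ} (hα : (∑ i, α i) ≤ l) {x : EE}
    (hx : x ∈ K) : ‖mderivE α f x‖ ≤ cSemiNorm l K f := by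
  -- a bound for each multi-index
  have hb : ∀ β : Fin d → ℕ, ∃ C : ℝ, 0 ≤ C ∧ ∀ y ∈ K, ‖mderivE β f y‖ ≤ C := by
    intro β
    obtain ⟨C, hC⟩ := hK.exists_bound_of_continuousOn (f := mderivE β f) (by
      rw [mderivE_eq]; exact (listDeriv_smooth hX hf _).continuousOn.mono hKX)
    exact ⟨max C 0, le_max_right _ _, fun y hy => (hC y hy).trans (le_max_left _ _)⟩
  choose C hC0 hC using hb
  have hfin : {β : Fin d → ℕ | (∑ i, β i) ≤ l}.Finite := by
    refine (Set.finite_Iic (fun _ : Fin d => l)).subset ?_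
    intro β hβ i
    exact (Finset.single_le_sum (f := β) (fun _ _ => Nat.zero_le _) (Finset.mem_univ i)).trans hβ
  have b1 : BddAbove (range fun y => ⨆ (_ : y ∈ K), ‖mderivE α f y‖) := by
    refine ⟨C α, ?_⟩
    rintro _ ⟨y, rfl⟩
    exact Real.iSup_le (fun hy => hC α y hy) (hC0 α)
  have b2 : BddAbove (range fun β : Fin d → ℕ =>
      ⨆ (_ : (∑ i, β i) ≤ l), ⨆ x ∈ K, ‖mderivE β f x‖) := by
    refine ⟨∑ β ∈ hfin.toFinset, C β, ?_⟩
    have hnn : 0 ≤ ∑ β ∈ hfin.toFinset, C β := Finset.sum_nonneg fun β _ => hC0 β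
    rintro _ ⟨β, rfl⟩
    refine Real.iSup_le (fun hβ => Real.iSup_le (fun y => Real.iSup_le (fun hy => ?_) hnn) hnn) hnn
    exact (hC β y hy).trans
      (Finset.single_le_sum (f := C) (fun β _ => hC0 β) (hfin.mem_toFinset.2 hβ))
  calc ‖mderivE α f x‖ = ⨆ (_ : x ∈ K), ‖mderivE α f x‖ := by rw [ciSup_pos hx]
    _ ≤ ⨆ y, ⨆ (_ : y ∈ K), ‖mderivE α f y‖ := le_ciSup b1 x
    _ = ⨆ (_ : (∑ i, α i) ≤ l), ⨆ x ∈ K, ‖mderivE α f x‖ := by rw [ciSup_pos hα]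
    _ ≤ cSemiNorm l K f := le_ciSup b2 α

lemma listDeriv_le (hX : IsOpen X) {K : Set EE} (hK : IsCompact K) (hKX : K ⊆ X) {f : EE → F}
    (hf : ContDiffOn ℝ (⊤ : ℕ∞) f X) {l : ℕ} {s : List (Fin d)} (hs : s.length ≤ l) {x : EE}
    (hx : x ∈ K) : ‖listDeriv s f x‖ ≤ cSemiNorm l K f := by
  rw [← listDeriv_perm hX hf (mlist_perm s) (hKX hx), ← mderivE_eq]
  refine le_cSemiNorm hX hK hKX hf ?_ hx
  rw [← mlist_length, (mlist_perm s).length_eq]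
  exact hs

lemma listDeriv_add (hX : IsOpen X) {f g : EE → F} (hf : ContDiffOn ℝ (⊤ : ℕ∞) f X)
    (hg : ContDiffOn ℝ (⊤ : ℕ∞) g X) (s : List (Fin d)) :
    EqOn (listDeriv s (fun x => f x + g x)) (fun x => listDeriv s f x + listDeriv s g x) X := by
  induction s with
  | nil => exact fun _ _ => rfl
  | cons i t ih =>
    intro x hx
    rw [listDeriv_cons, pderivE_congr hX ih i hx]
    simp only [pderivE, listDeriv_cons]
    rw [fderiv_fun_add (sm_diffAt hX (listDeriv_smooth hX hf t) hx)
      (sm_diffAt hX (listDeriv_smooth hX hg t) hx)]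
    rfl

lemma listDeriv_zero (s : List (Fin d)) : listDeriv s (fun _ : EE => (0 : F)) = fun _ => 0 := by
  induction s with
  | nil => rfl
  | cons i t ih =>
    rw [listDeriv_cons, ih]
    funext x
    simp [pderivE]

lemma listDeriv_sum (hX : IsOpen X) {ι : Type*} (T : Finset ι) {f : ι → EE → F}
    (hf : ∀ i, ContDiffOn ℝ (⊤ : ℕ∞) (f i) X) (s : List (Fin d)) :
    EqOn (listDeriv s (fun x => ∑ i ∈ T, f i x)) (fun x => ∑ i ∈ T, listDeriv s (f i) x) X := by
  classical
  induction T using Finset.induction_on with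
  | empty => intro x _; simp [listDeriv_zero]
  | insert a T ha ih =>
    intro x hx
    simp only [Finset.sum_insert ha]
    rw [listDeriv_add hX (hf a) (ContDiffOn.sum fun i _ => hf i) s hx]
    simp only [ih hx]

variable {𝕂 : Type*} [RCLike 𝕂]

lemma pderivE_weighted (hX : IsOpen X) {φ : EE → EE} (hφ : ContDiffOn ℝ (⊤ : ℕ∞) φ X)
    (hφX : MapsTo φ X X) {a f : EE → 𝕂} (ha : ContDiffOn ℝ (⊤ : ℕ∞) a X)
    (hf : ContDiffOn ℝ (⊤ : ℕ∞) f X) (i : Fin d) :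
    EqOn (pderivE i (fun x => a x * f (φ x)))
      (fun x => pderivE i a x * f (φ x) +
        ∑ j, ((pderivE i φ x j) • a x) * pderivE j f (φ x)) X := by
  intro x hx
  have h1 : HasFDerivAt (fun x => f (φ x)) ((fderiv ℝ f (φ x)).comp (fderiv ℝ φ x)) x :=
    (sm_diffAt hX hf (hφX hx)).hasFDerivAt.comp x (sm_diffAt hX hφ hx).hasFDerivAt
  have h2 := (sm_diffAt hX ha hx).hasFDerivAt.mul h1
  have h3 : pderivE i (fun x => a x * f (φ x)) x =
      a x * fderiv ℝ f (φ x) (pderivE i φ x) + pderivE i a x * f (φ x) := by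
    simp only [pderivE]
    rw [show (fun x => a x * f (φ x)) = a * (fun x => f (φ x)) from rfl, h2.fderiv]
    simp [mul_comm]
  have h4 : ∀ v : EE, fderiv ℝ f (φ x) v = ∑ j, v j • pderivE j f (φ x) := by
    intro v
    have hv : v = ∑ j, v j • EuclideanSpace.single j (1 : ℝ) := by
      ext k
      simp [Finset.sum_apply, Pi.single_apply]
    conv_lhs => rw [hv]
    simp [pderivE]
  rw [h3, h4, Finset.mul_sum, add_comm]
  simp

lemma weighted_bound (hX : IsOpen X) {φ : EE → EE} (hφ : ContDiffOn ℝ (⊤ : ℕ∞) φ X)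
    (hφX : MapsTo φ X X) {K : Set EE} (hK : IsCompact K) (hKX : K ⊆ X) (s : List (Fin d)) :
    ∀ a : EE → 𝕂, ContDiffOn ℝ (⊤ : ℕ∞) a X → ∃ γ : ℝ, 0 ≤ γ ∧
      ∀ f : EE → 𝕂, ContDiffOn ℝ (⊤ : ℕ∞) f X → ∀ M : ℝ, 
        (∀ t : List (Fin d), t.length ≤ s.length → ∀ x ∈ K, ‖listDeriv t f (φ x)‖ ≤ M) →
        ∀ x ∈ K, ‖listDeriv s (fun x => a x * f (φ x)) x‖ ≤ γ * M := by
  induction s using List.reverseRecOn with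
  | nil =>
    intro a ha
    obtain ⟨C, hC⟩ := hK.exists_bound_of_continuousOn (ha.continuousOn.mono hKX)
    refine ⟨max C 0, le_max_right _ _, fun f _ M hM x hx => ?_⟩
    have h1 := hM [] le_rfl x hx
    have h2 := (hC x hx).trans (le_max_left C 0)
    simp only [listDeriv, List.foldr_nil, norm_mul] at h1 ⊢
    exact mul_le_mul h2 h1 (norm_nonneg _) (le_max_right _ _)
  | append_singleton s i ih =>
    intro a ha
    have hcoef : ∀ j : Fin d, ContDiffOn ℝ (⊤ : ℕ∞) (fun x => (pderivE i φ x j) • a x) X := by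
      intro j
      exact ((contDiffOn_euclidean.1 (pderivE_smooth hX hφ i)) j).smul ha
    obtain ⟨γ0, hγ0, h0⟩ := ih (pderivE i a) (pderivE_smooth hX ha i)
    choose γ hγ h using fun j => ih _ (hcoef j)
    refine ⟨γ0 + ∑ j, γ j, add_nonneg hγ0 (Finset.sum_nonneg fun j _ => hγ j), ?_⟩
    intro f hf M hM x hx
    rw [listDeriv_append]
    have hpf := fun j => pderivE_smooth hX hf j
    have e1 := listDeriv_congr hX (pderivE_weighted hX hφ hφX ha hf i) s (hKX hx)
    have hsm : ∀ j, ContDiffOn ℝ (⊤ : ℕ∞)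
        (fun x => ((pderivE i φ x j) • a x) * pderivE j f (φ x)) X :=
      fun j => (hcoef j).mul ((hpf j).comp hφ hφX)
    have e2 := listDeriv_add hX ((pderivE_smooth hX ha i).mul (hf.comp hφ hφX))
      (ContDiffOn.sum (s := Finset.univ) fun j _ => hsm j) s (hKX hx)
    have e3 := listDeriv_sum hX Finset.univ hsm s (hKX hx)
    have e : listDeriv s (listDeriv [i] fun x => a x * f (φ x)) x =
        listDeriv s (fun x => pderivE i a x * f (φ x)) x +
        ∑ j, listDeriv s (fun x => ((pderivE i φ x j) • a x) * pderivE j f (φ x)) x := by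
      refine e1.trans (e2.trans ?_)
      exact congrArg _ e3
    rw [e, add_mul, Finset.sum_mul]
    refine (norm_add_le _ _).trans (add_le_add ?_ ?_)
    · refine h0 f hf M (fun t ht y hy => hM t ?_ y hy) x hx
      simp; omega
    · refine (norm_sum_le _ _).trans (Finset.sum_le_sum fun j _ => ?_)
      refine h j (pderivE j f) (hpf j) M (fun t ht y hy => ?_) x hx
      have := hM (t ++ [j]) (by simpa using ht) y hy
      rwa [listDeriv_append] at this

end deriv

end aux

/-- For a smooth, locally injective symbol `ψ` and a smooth weight `w`
whose non-vanishing set is dense, the weighted composition operator `C_{w,ψ}` is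
topologizable on `C^∞(X)` if and only if `ψ` has stable orbits. -/
theorem topologizable_iff_stable_orbits_smooth
    {d : ℕ} {𝕂 : Type*} [RCLike 𝕂]
    (X : Set (EuclideanSpace ℝ (Fin d))) (hX : IsOpen X)
    (w : EuclideanSpace ℝ (Fin d) → 𝕂) (hw : ContDiffOn ℝ (⊤ : ℕ∞) w X)
    (hwdense : X ⊆ closure {x ∈ X | w x ≠ 0})
    (ψ : EuclideanSpace ℝ (Fin d) → EuclideanSpace ℝ (Fin d))
    (hψ : ContDiffOn ℝ (⊤ : ℕ∞) ψ X) (hψX : Set.MapsTo ψ X X)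
    (hloc : ∀ x ∈ X, ∃ U : Set (EuclideanSpace ℝ (Fin d)),
      IsOpen U ∧ x ∈ U ∧ U ⊆ X ∧ Set.InjOn ψ U) :
    -- topologizability of C_{w,ψ} on C^∞(X)
    (∀ (l : ℕ) (K : Set (EuclideanSpace ℝ (Fin d))), IsCompact K → K ⊆ X →
      ∃ (l' : ℕ) (L : Set (EuclideanSpace ℝ (Fin d))), IsCompact L ∧ L ⊆ X ∧
        ∀ m : ℕ, 1 ≤ m → ∃ γ : ℝ, 0 < γ ∧
          ∀ f : EuclideanSpace ℝ (Fin d) → 𝕂, ContDiffOn ℝ (⊤ : ℕ∞) f X →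
            cSemiNorm l K
                (fun x => (∏ j ∈ Finset.range m, w (ψ^[j] x)) * f (ψ^[m] x)) ≤
              γ * cSemiNorm l' L f) ↔
    -- ψ has stable orbits
    (∀ K : Set (EuclideanSpace ℝ (Fin d)), IsCompact K → K ⊆ X →
      ∃ L : Set (EuclideanSpace ℝ (Fin d)), IsCompact L ∧ L ⊆ X ∧
        ∀ m : ℕ, 1 ≤ m → ψ^[m] '' K ⊆ L) := by
  have hiter : ∀ m : ℕ, Set.MapsTo ψ^[m] X X := fun m => hψX.iterate m
  have hiters : ∀ m : ℕ, ContDiffOn ℝ (⊤ : ℕ∞) ψ^[m] X := by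
    intro m
    induction m with
    | zero => exact contDiffOn_id
    | succ m ih => exact ih.comp hψ hψX
  have hprod : ∀ m : ℕ, ContDiffOn ℝ (⊤ : ℕ∞) (fun x => ∏ j ∈ Finset.range m, w (ψ^[j] x)) X :=
    fun m => contDiffOn_prod fun j _ => hw.comp (hiters j) (hiter j)
  constructor
  · intro h K hK hKX
    obtain ⟨K', hK', hKK', hK'X⟩ := exists_compact_between hK hX hKX
    obtain ⟨l', L, hL, hLX, hm⟩ := h 0 K' hK' hK'X
    refine ⟨L, hL, hLX, ?_⟩
    rintro m hm1 _ ⟨x, hx, rfl⟩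
    by_contra hxL
    obtain ⟨γ, hγ, hf⟩ := hm m hm1
    have hVo : IsOpen (interior K' ∩ ψ^[m] ⁻¹' Lᶜ) :=
      ((hiters m).continuousOn.mono (interior_subset.trans hK'X)).isOpen_inter_preimage
        isOpen_interior hL.isClosed.isOpen_compl
    obtain ⟨z, ⟨hzK, hzL⟩, hz⟩ := dense_prod hw.continuousOn hwdense hψ hψX hloc m _ hVo
      (Set.inter_subset_left.trans (interior_subset.trans hK'X)) ⟨x, hKK' hx, hxL⟩
    obtain ⟨g, hgs, -, hg, -, hg1⟩ := exists_contDiff_tsupport_subset (n := (⊤ : ℕ∞))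
      (hL.isClosed.isOpen_compl.mem_nhds hzL)
    have hfs : ContDiff ℝ (⊤ : ℕ∞) (fun y => ((g y : ℝ) : 𝕂)) :=
      (RCLike.ofRealCLM (K := 𝕂)).contDiff.comp hg
    have hest := hf _ hfs.contDiffOn
    have hzero : cSemiNorm l' L (fun y => ((g y : ℝ) : 𝕂)) ≤ 0 := by
      refine cSemiNorm_le _ _ _ le_rfl fun α _ y hy => ?_
      have hop : IsOpen (tsupport g)ᶜ := (isClosed_tsupport g).isOpen_compl
      have heq : Set.EqOn (fun y => ((g y : ℝ) : 𝕂)) (fun _ => 0) (tsupport g)ᶜ := by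
        intro y hy
        simp [image_eq_zero_of_notMem_tsupport hy]
      rw [mderivE_eq, listDeriv_congr hop heq _ (fun hy' => hgs hy' hy), listDeriv_zero, norm_zero]
    have hsm : ContDiffOn ℝ (⊤ : ℕ∞)
        (fun x => (∏ j ∈ Finset.range m, w (ψ^[j] x)) * ((g (ψ^[m] x) : ℝ) : 𝕂)) X :=
      (hprod m).mul (hfs.contDiffOn.comp (hiters m) (hiter m))
    have hlow := le_cSemiNorm hX hK' hK'X hsm (l := 0) (α := fun _ => 0) (by simp)
      (interior_subset hzK)
    have h0 : mderivE (fun _ => 0)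
        (fun x => (∏ j ∈ Finset.range m, w (ψ^[j] x)) * ((g (ψ^[m] x) : ℝ) : 𝕂)) z =
        ∏ j ∈ Finset.range m, w (ψ^[j] z) := by
      have : mlist (fun _ : Fin d => 0) = [] := by simp [mlist]
      rw [mderivE_eq, this]
      simp [listDeriv, hg1]
    rw [h0] at hlow
    have hpos : 0 < ‖∏ j ∈ Finset.range m, w (ψ^[j] z)‖ := norm_pos_iff.2 hz
    have := mul_nonpos_of_nonneg_of_nonpos hγ.le hzero
    linarith
  · intro h l K hK hKX
    obtain ⟨L, hL, hLX, hKL⟩ := h K hK hKX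
    refine ⟨l, L, hL, hLX, fun m hm => ?_⟩
    choose γ hγ hb using fun s : List (Fin d) =>
      weighted_bound hX (hiters m) (hiter m) hK hKX s _ (hprod m)
    have hfin : {β : Fin d → ℕ | (∑ i, β i) ≤ l}.Finite := by
      refine (Set.finite_Iic (fun _ : Fin d => l)).subset ?_
      intro β hβ i
      exact (Finset.single_le_sum (f := β) (fun _ _ => Nat.zero_le _) (Finset.mem_univ i)).trans hβ
    have hnn : 0 ≤ ∑ β ∈ hfin.toFinset, γ (mlist β) := Finset.sum_nonneg fun β _ => hγ _
    refine ⟨1 + ∑ β ∈ hfin.toFinset, γ (mlist β), by linarith, fun f hf => ?_⟩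
    have hN := cSemiNorm_nonneg l L f
    refine cSemiNorm_le _ _ _ (mul_nonneg (by linarith) hN) fun α hα x hx => ?_
    rw [mderivE_eq]
    refine (hb (mlist α) f hf (cSemiNorm l L f) (fun t ht y hy => ?_) x hx).trans ?_
    · rw [mlist_length] at ht
      exact listDeriv_le hX hL hLX hf (ht.trans hα) (hKL m hm ⟨y, hy, rfl⟩)
    · refine mul_le_mul_of_nonneg_right ?_ hN
      have := Finset.single_le_sum (f := fun β => γ (mlist β)) (fun β _ => hγ _)
        (hfin.mem_toFinset.2 hα)
      linarith

end
end
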